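/- Let n be a positive integer, ρ a density matrix on R⊗A, and σ a density matrix on A. For each x ∈ {1,…,n} let τ_x = ρ^{RA_x} ⊗ (⊗_{i≠x} σ^{A_i}) on R⊗A₁⊗…⊗A_n (each A_i a copy of A), let τ = (1/n) Σ_{x=1}^n τ_x, and set μ := Q₂(ρ^{RA} ‖ ρ^R ⊗ σ) − 1 with ρ^R = Tr_A ρ. Then the Umegaki relative entropy satisfies D(τ ‖ ρ^R ⊗ σ^{⊗n}) ≤ log(1 + μ/n). -/

import Mathlib

open scoped Matrix Kronecker BigOperators ENNReal ComplexOrder Classical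

noncomputable section

variable {d : Type*} [Fintype d] [DecidableEq d]

/-- Apply a real function to the eigenvalues of a Hermitian matrix (spectral
functional calculus). -/
def herFun {A : Matrix d d ℂ} (hA : A.IsHermitian) (f : ℝ → ℝ) : Matrix d d ℂ :=
  (hA.eigenvectorUnitary : Matrix d d ℂ) *
    Matrix.diagonal (fun i => (f (hA.eigenvalues i) : ℂ)) *
    (hA.eigenvectorUnitary : Matrix d d ℂ)ᴴ

/-- Functional calculus, extended by the junk value `0` to non-Hermitian matrices. -/
def matFun (A : Matrix d d ℂ) (f : ℝ → ℝ) : Matrix d d ℂ :=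
  if h : A.IsHermitian then herFun h f else 0

/-- Real power of a Hermitian matrix, taken on its support (Moore–Penrose
convention: zero eigenvalues are sent to zero; negative powers are pseudo-inverses). -/
def matPow (A : Matrix d d ℂ) (r : ℝ) : Matrix d d ℂ :=
  matFun A (fun x => if x = 0 then 0 else Real.rpow x r)

/-- Logarithm of a Hermitian matrix on its support. -/
def matLog (A : Matrix d d ℂ) : Matrix d d ℂ := matFun A Real.log

/-- A density matrix: positive semidefinite with unit trace. -/
def IsDensity (A : Matrix d d ℂ) : Prop := A.PosSemidef ∧ A.trace = 1

/-- `suppLE ρ σ` : the support of `ρ` is contained in the support of `σ`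
(for Hermitian matrices this is equivalent to `ker σ ≤ ker ρ`). -/
def suppLE (ρ σ : Matrix d d ℂ) : Prop :=
  LinearMap.ker σ.mulVecLin ≤ LinearMap.ker ρ.mulVecLin

/-- Trace (nuclear) norm of a matrix: `Tr √(AᴴA)`. -/
def traceNorm (A : Matrix d d ℂ) : ℝ := (Matrix.trace (matPow (Aᴴ * A) (1/2))).re

/-- The real-valued collision quantity `Tr[ρ σ^{-1/2} ρ σ^{-1/2}]`. -/
def Q2R (ρ σ : Matrix d d ℂ) : ℝ :=
  (Matrix.trace (ρ * matPow σ (-(1/2)) * ρ * matPow σ (-(1/2)))).re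

/-- `Q₂(ρ‖σ) = Tr[ρ σ^{-1/2} ρ σ^{-1/2}]`, equal to `+∞` unless `supp ρ ⊆ supp σ`. -/
def Q2 (ρ σ : Matrix d d ℂ) : ℝ≥0∞ :=
  if suppLE ρ σ then ENNReal.ofReal (Q2R ρ σ) else ∞

/-- Collision relative entropy `D₂(ρ‖σ) = log Q₂(ρ‖σ)`. -/
def D2 (ρ σ : Matrix d d ℂ) : EReal := ENNReal.log (Q2 ρ σ)

/-- Fidelity `F(ρ,σ) = ‖√ρ √σ‖₁`. -/
def fidelity (ρ σ : Matrix d d ℂ) : ℝ := traceNorm (matPow ρ (1/2) * matPow σ (1/2))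

/-- Purified distance `P(ρ,σ) = √(1 - F(ρ,σ)²)`. -/
def purifiedDist (ρ σ : Matrix d d ℂ) : ℝ := Real.sqrt (1 - fidelity ρ σ ^ 2)

variable {R A : Type*} [Fintype R] [DecidableEq R] [Fintype A] [DecidableEq A]

/-- Partial trace over the second tensor factor. -/
def ptrace2 (ρ : Matrix (R × A) (R × A) ℂ) : Matrix R R ℂ :=
  Matrix.of fun i j => ∑ a : A, ρ (i, a) (j, a)

/-- `n`-fold tensor power `σ^{⊗n}` of a matrix `σ`. -/
def tpow (σ : Matrix A A ℂ) (n : ℕ) : Matrix (Fin n → A) (Fin n → A) ℂ :=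
  Matrix.of fun v w => ∏ k, σ (v k) (w k)

/-- The state `τ_x = ρ^{R A_x} ⊗ (⊗_{i ≠ x} σ^{A_i})` on `R ⊗ A₁ ⊗ ⋯ ⊗ A_n`. -/
def tauX (ρ : Matrix (R × A) (R × A) ℂ) (σ : Matrix A A ℂ) (n : ℕ) (x : Fin n) :
    Matrix (R × (Fin n → A)) (R × (Fin n → A)) ℂ :=
  Matrix.of fun p q =>
    ρ (p.1, p.2 x) (q.1, q.2 x) * ∏ k ∈ Finset.univ.erase x, σ (p.2 k) (q.2 k)

/-- Umegaki relative entropy `D(ρ‖σ) = Tr[ρ log ρ] − Tr[ρ log σ]`,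
equal to `+∞` unless `supp ρ ⊆ supp σ`. -/
def relEnt (ρ σ : Matrix d d ℂ) : EReal :=
  if suppLE ρ σ then (((ρ * matLog ρ).trace.re - ((ρ * matLog σ).trace.re) : ℝ) : EReal)
  else ⊤

theorem matFun_of_diag {M : Matrix d d ℂ} (U : Matrix d d ℂ) (x : d → ℝ) (hU : Uᴴ * U = 1)
    (hM : M = U * Matrix.diagonal (fun i => (x i : ℂ)) * Uᴴ) (f : ℝ → ℝ) :
    matFun M f = U * Matrix.diagonal (fun i => (f (x i) : ℂ)) * Uᴴ := by
  have hU' : U * Uᴴ = 1 := mul_eq_one_comm.mp hU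
  have hH : M.IsHermitian := by
    rw [hM]
    refine Matrix.isHermitian_mul_mul_conjTranspose _ ?_
    rw [Matrix.isHermitian_diagonal_iff]
    intro i
    simp [IsSelfAdjoint]
  rw [matFun, dif_pos hH, herFun]
  set V : Matrix d d ℂ := (hH.eigenvectorUnitary : Matrix d d ℂ) with hV
  have hVV : V * Vᴴ = 1 := Unitary.mul_star_self_of_mem hH.eigenvectorUnitary.2
  have hVV' : Vᴴ * V = 1 := Unitary.star_mul_self_of_mem hH.eigenvectorUnitary.2
  have hs : M = V * Matrix.diagonal (fun i => (hH.eigenvalues i : ℂ)) * Vᴴ := by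
    have := hH.spectral_theorem
    rw [Unitary.conjStarAlgAut_apply] at this
    exact this
  have key : Matrix.diagonal (fun i => (hH.eigenvalues i : ℂ)) * (Vᴴ * U)
      = (Vᴴ * U) * Matrix.diagonal (fun i => (x i : ℂ)) := by
    have h1 : Vᴴ * M * U = Matrix.diagonal (fun i => (hH.eigenvalues i : ℂ)) * (Vᴴ * U) := by
      conv_lhs => rw [hs]
      simp only [← Matrix.mul_assoc, hVV', Matrix.one_mul]
    have h2 : Vᴴ * M * U = (Vᴴ * U) * Matrix.diagonal (fun i => (x i : ℂ)) := by
      conv_lhs => rw [hM]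
      simp only [Matrix.mul_assoc, hU, Matrix.mul_one]
    rw [← h1, h2]
  have key2 : Matrix.diagonal (fun i => (f (hH.eigenvalues i) : ℂ)) * (Vᴴ * U)
      = (Vᴴ * U) * Matrix.diagonal (fun i => (f (x i) : ℂ)) := by
    ext i j
    have := congrFun (congrFun key i) j
    rw [Matrix.diagonal_mul, Matrix.mul_diagonal] at this ⊢
    by_cases h0 : (Vᴴ * U) i j = 0
    · simp [h0]
    · rw [mul_comm] at this
      have h3 := mul_left_cancel₀ h0 this
      have h4 : hH.eigenvalues i = x j := by exact_mod_cast h3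
      rw [h4, mul_comm]
  calc V * Matrix.diagonal (fun i => (f (hH.eigenvalues i) : ℂ)) * Vᴴ
      = V * (Matrix.diagonal (fun i => (f (hH.eigenvalues i) : ℂ)) * (Vᴴ * U)) * Uᴴ := by
        simp only [Matrix.mul_assoc, hU', Matrix.mul_one]
    _ = _ := by
        rw [key2]
        simp only [← Matrix.mul_assoc, hVV, Matrix.one_mul]

theorem exists_diag {M : Matrix d d ℂ} (hM : M.PosSemidef) :
    ∃ (U : Matrix d d ℂ) (x : d → ℝ), Uᴴ * U = 1 ∧ (∀ i, 0 ≤ x i) ∧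
      M = U * Matrix.diagonal (fun i => (x i : ℂ)) * Uᴴ := by
  refine ⟨hM.1.eigenvectorUnitary, hM.1.eigenvalues, 
    Unitary.star_mul_self_of_mem hM.1.eigenvectorUnitary.2, hM.eigenvalues_nonneg, ?_⟩
  have := hM.1.spectral_theorem
  rw [Unitary.conjStarAlgAut_apply] at this
  exact this

theorem exists_sq {M : Matrix d d ℂ} (hM : M.PosSemidef) : ∃ C : Matrix d d ℂ, M = Cᴴ * C := by
  obtain ⟨U, x, hU, hx, h⟩ := exists_diag hM
  refine ⟨Matrix.diagonal (fun i => ((Real.sqrt (x i) : ℝ) : ℂ)) * Uᴴ, ?_⟩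
  rw [h, Matrix.conjTranspose_mul, Matrix.conjTranspose_conjTranspose,
    Matrix.diagonal_conjTranspose, Matrix.mul_assoc U (Matrix.diagonal (star _)),
    ← Matrix.mul_assoc _ _ Uᴴ, Matrix.diagonal_mul_diagonal, Matrix.mul_assoc]
  congr 3
  ext i
  simp only [Pi.star_apply, RCLike.star_def, Complex.conj_ofReal]
  rw [← Complex.ofReal_mul, Real.mul_self_sqrt (hx i)]

theorem trace_four_nonneg {M A Y : Matrix d d ℂ} (hM : M.PosSemidef) (hA : A.PosSemidef)
    (hY : Yᴴ = Y) : 0 ≤ (M * Y * A * Y).trace.re := by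
  obtain ⟨C, hC⟩ := exists_sq hM
  have h : (M * Y * A * Y).trace = (C * (Y * A * Y) * Cᴴ).trace := by
    rw [Matrix.trace_mul_comm (C * (Y * A * Y)), hC]
    simp only [Matrix.mul_assoc]
  rw [h]
  have h1 : (Y * A * Y).PosSemidef := by
    have := hA.mul_mul_conjTranspose_same Y
    rwa [hY] at this
  have h2 := (h1.mul_mul_conjTranspose_same C).trace_nonneg
  exact (Complex.le_def.mp h2).1

/-- Pointwise (in `t`) tangent inequality. -/
theorem pointwise_ineq (W : Matrix d d ℂ) (r s : d → ℝ) (hW : Wᴴ * W = 1) (hr : ∀ i, 0 ≤ r i)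
    (hs : ∀ i, 0 ≤ s i) (M : Matrix d d ℂ)
    (hM : M = W * Matrix.diagonal (fun i => (r i : ℂ)) * Wᴴ) (t : ℝ) (ht : 0 < t) :
    0 ≤ ∑ i, r i / (r i + t) - 2 * ∑ j, (M j j).re / (s j + t)
      + ∑ i, ∑ j, Complex.normSq (M i j) / ((s i + t) * (s j + t))
      + t * ∑ j, (M j j).re / (s j + t) ^ 2 := by
  have hW' : W * Wᴴ = 1 := mul_eq_one_comm.mp hW
  set X : Matrix d d ℂ := W * Matrix.diagonal (fun i => (((r i + t)⁻¹ : ℝ) : ℂ)) * Wᴴ with hX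
  set B : Matrix d d ℂ := Matrix.diagonal (fun i => (((s i + t)⁻¹ : ℝ) : ℂ)) with hB
  set A : Matrix d d ℂ := W * Matrix.diagonal (fun i => ((r i + t : ℝ) : ℂ)) * Wᴴ with hA
  have hD : ∀ f : d → ℝ, (Matrix.diagonal (fun i => (f i : ℂ)))ᴴ
      = Matrix.diagonal (fun i => (f i : ℂ)) := by
    intro f
    rw [Matrix.diagonal_conjTranspose]
    congr 1
    ext i
    simp
  have hpsd : ∀ f : d → ℝ, (∀ i, 0 ≤ f i) →
      (W * Matrix.diagonal (fun i => (f i : ℂ)) * Wᴴ).PosSemidef := by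
    intro f hf
    refine Matrix.PosSemidef.mul_mul_conjTranspose_same ?_ W
    refine Matrix.PosSemidef.diagonal ?_
    intro i
    exact Complex.zero_le_real.mpr (hf i)
  have hmul : ∀ f g : d → ℝ, (W * Matrix.diagonal (fun i => (f i : ℂ)) * Wᴴ) *
      (W * Matrix.diagonal (fun i => (g i : ℂ)) * Wᴴ)
      = W * Matrix.diagonal (fun i => ((f i * g i : ℝ) : ℂ)) * Wᴴ := by
    intro f g
    calc _ = W * Matrix.diagonal (fun i => (f i : ℂ)) * (Wᴴ * W) *
          Matrix.diagonal (fun i => (g i : ℂ)) * Wᴴ := by simp only [Matrix.mul_assoc]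
      _ = _ := by
        rw [hW, Matrix.mul_one, Matrix.mul_assoc W, Matrix.diagonal_mul_diagonal]
        simp
  have hMp : M.PosSemidef := by rw [hM]; exact hpsd r hr
  have hAp : A.PosSemidef := hpsd _ (fun i => by have := hr i; positivity)
  have hXH : Xᴴ = X := (hpsd _ (fun i => by have := hr i; positivity)).1
  have hBH : Bᴴ = B := hD _
  have hAM : A = M + (t : ℂ) • (1 : Matrix d d ℂ) := by
    have : (fun i => ((r i + t : ℝ) : ℂ)) = fun i => ((r i : ℂ)) + (t : ℂ) := by
      ext i; push_cast; rfl
    rw [hA, this, ← Matrix.diagonal_add, Matrix.mul_add, Matrix.add_mul, ← hM]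
    congr 1
    rw [← Matrix.smul_one_eq_diagonal]
    simp [hW']
  have hone : ∀ f : d → ℝ, (∀ i, f i = 1) → 
      W * Matrix.diagonal (fun i => (f i : ℂ)) * Wᴴ = 1 := by
    intro f hf
    have : (fun i => (f i : ℂ)) = fun _ => 1 := by ext i; rw [hf]; simp
    rw [this, Matrix.diagonal_one, Matrix.mul_one, hW']
  have hAX : A * X = 1 := by
    rw [hA, hX, hmul]
    exact hone _ (fun i => mul_inv_cancel₀ (by have := hr i; positivity))
  have hXA : X * A = 1 := mul_eq_one_comm.mp hAX
  have h0 := trace_four_nonneg (Y := X - B) hMp hAp (by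
    rw [Matrix.conjTranspose_sub, hXH, hBH])
  have hexp : M * (X - B) * A * (X - B)
      = M * X - M * B - M * B + (M * B * M * B + (t : ℂ) • (M * (B * B))) := by
    have e1 : M * (X - B) * A * (X - B) = M * ((X * A) * X - (X * A) * B - B * (A * X) + B * A * B) := by
      noncomm_ring
    rw [e1, hXA, hAX, hAM]
    simp only [Matrix.one_mul, Matrix.mul_one, Matrix.mul_add, Matrix.mul_sub, Matrix.add_mul,
      Matrix.mul_smul, Matrix.smul_mul, Matrix.mul_assoc]
  rw [hexp] at h0
  have t1 : (M * X).trace.re = ∑ i, r i / (r i + t) := by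
    rw [hM, hX, hmul, Matrix.trace_mul_comm, ← Matrix.mul_assoc, hW, Matrix.one_mul,
      Matrix.trace_diagonal, Complex.re_sum]
    rfl
  have t2 : (M * B).trace.re = ∑ j, (M j j).re / (s j + t) := by
    rw [Matrix.trace, Complex.re_sum]
    refine Finset.sum_congr rfl fun j _ => ?_
    rw [Matrix.diag_apply, hB, Matrix.mul_diagonal, Complex.re_mul_ofReal]
    rfl
  have t3 : (M * (B * B)).trace.re = ∑ j, (M j j).re / (s j + t) ^ 2 := by
    rw [Matrix.trace, Complex.re_sum]
    refine Finset.sum_congr rfl fun j _ => ?_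
    rw [Matrix.diag_apply, hB, Matrix.diagonal_mul_diagonal, Matrix.mul_diagonal,
      ← Complex.ofReal_mul, Complex.re_mul_ofReal]
    rw [div_eq_mul_inv, ← mul_inv, sq]
  have t4 : (M * B * M * B).trace.re
      = ∑ i, ∑ j, Complex.normSq (M i j) / ((s i + t) * (s j + t)) := by
    rw [Matrix.trace, Complex.re_sum]
    refine Finset.sum_congr rfl fun i _ => ?_
    rw [Matrix.diag_apply, hB, Matrix.mul_diagonal, Matrix.mul_apply, Finset.sum_mul,
      Complex.re_sum]
    refine Finset.sum_congr rfl fun j _ => ?_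
    rw [Matrix.mul_diagonal]
    have hc : M j i = (starRingEnd ℂ) (M i j) := (hMp.1.apply j i).symm
    rw [hc, mul_right_comm (M i j), Complex.mul_conj, Complex.re_mul_ofReal, 
      ← Complex.ofReal_mul, Complex.ofReal_re, div_eq_mul_inv, mul_inv]
    ring
  simp only [Complex.add_re, Complex.sub_re, Matrix.trace_add, Matrix.trace_sub,
    Matrix.trace_smul, smul_eq_mul, Complex.re_ofReal_mul, t1, t2, t3, t4] at h0
  linarith
theorem inv_sqrt_deriv_bound (a b : ℝ) (ha : 0 < a) (hb : 0 < b) :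
    1 / (a * b) ≤ (a + b) / (2 * (Real.sqrt a * Real.sqrt b) * (a * b)) := by
  have h1 := Real.sqrt_pos.mpr ha
  have h2 := Real.sqrt_pos.mpr hb
  rw [div_le_div_iff₀ (by positivity) (by positivity)]
  have h3 : 2 * (Real.sqrt a * Real.sqrt b) ≤ a + b := by
    nlinarith [sq_nonneg (Real.sqrt a - Real.sqrt b), Real.mul_self_sqrt ha.le,
      Real.mul_self_sqrt hb.le]
  nlinarith [mul_pos ha hb]

theorem hasDerivAt_inv_sqrt (a b t : ℝ) (ha : 0 < a + t) (hb : 0 < b + t) :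
    HasDerivAt (fun t => 1 / (Real.sqrt (a + t) * Real.sqrt (b + t)))
      (-((a + t + (b + t)) / (2 * (Real.sqrt (a + t) * Real.sqrt (b + t)) * ((a + t) * (b + t))))) t := by
  have h1 := Real.sqrt_pos.mpr ha
  have h2 := Real.sqrt_pos.mpr hb
  have d1 : HasDerivAt (fun t => Real.sqrt (a + t)) (1 / (2 * Real.sqrt (a + t))) t :=
    ((hasDerivAt_id t).const_add a).sqrt ha.ne'
  have d2 : HasDerivAt (fun t => Real.sqrt (b + t)) (1 / (2 * Real.sqrt (b + t))) t :=
    ((hasDerivAt_id t).const_add b).sqrt hb.ne'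
  have d3 := (d1.mul d2).inv (by simp only [Pi.mul_apply]; positivity)
  simp only [one_div] at d3 ⊢
  refine HasDerivAt.congr_deriv d3 ?_
  simp only [Pi.mul_apply]
  have e1 := Real.sq_sqrt ha.le
  have e2 := Real.sq_sqrt hb.le
  set u := Real.sqrt (a + t)
  set v := Real.sqrt (b + t)
  rw [← e1, ← e2]
  field_simp
  ring

open Filter Topology in
theorem tendsto_log_ratio (a : ℝ) :
    Tendsto (fun t : ℝ => Real.log (a + t) - Real.log (1 + t)) atTop (𝓝 0) := by
  have h : Tendsto (fun t : ℝ => (a - 1) / (1 + t) + 1) atTop (𝓝 (0 + 1)) := by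
    refine Tendsto.add_const 1 ?_
    exact Tendsto.div_atTop tendsto_const_nhds (tendsto_atTop_add_const_left _ _ tendsto_id)
  rw [zero_add] at h
  have h2 := (Real.continuousAt_log one_ne_zero).tendsto.comp h
  rw [Real.log_one] at h2
  refine h2.congr' ?_
  filter_upwards [eventually_gt_atTop 0, eventually_gt_atTop (-a)] with t ht ht2
  rw [Function.comp_apply, ← Real.log_div (by linarith) (by linarith)]
  congr 1
  have : (1 + t) ≠ 0 := by linarith
  field_simp
  ring

open Filter Topology in
theorem scalar_ineq (W : Matrix d d ℂ) (r s : d → ℝ) (hW : Wᴴ * W = 1) (hr : ∀ i, 0 ≤ r i)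
    (hs : ∀ i, 0 ≤ s i) (M : Matrix d d ℂ)
    (hM : M = W * Matrix.diagonal (fun i => (r i : ℂ)) * Wᴴ)
    (hr1 : ∑ i, r i = 1) (hM1 : ∑ j, (M j j).re = 1)
    (h0 : ∀ i j, s j = 0 → M i j = 0) (h0' : ∀ i j, s i = 0 → M i j = 0) :
    ∑ i, r i * Real.log (r i) - ∑ j, (M j j).re * Real.log (s j)
      ≤ ∑ i, ∑ j, Complex.normSq (M i j) * (1 / (Real.sqrt (s i) * Real.sqrt (s j))) - 1 := by
  set G : ℝ → ℝ := fun t => ∑ i, r i * (Real.log (r i + t) - Real.log (1 + t))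
    - ∑ j, (M j j).re * (Real.log (s j + t) - Real.log (1 + t))
    - ∑ i, ∑ j, Complex.normSq (M i j) * (1 / (Real.sqrt (s i + t) * Real.sqrt (s j + t)))
    + ∑ j, (M j j).re * (s j / (s j + t)) with hG
  set G' : ℝ → ℝ := fun t => ∑ i, r i * (1 / (r i + t) - 1 / (1 + t))
    - ∑ j, (M j j).re * (1 / (s j + t) - 1 / (1 + t))
    - ∑ i, ∑ j, Complex.normSq (M i j) * (-((s i + t + (s j + t)) /
        (2 * (Real.sqrt (s i + t) * Real.sqrt (s j + t)) * ((s i + t) * (s j + t)))))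
    + ∑ j, (M j j).re * (-(s j / (s j + t) ^ 2)) with hG'
  have hlog : ∀ a t : ℝ, 0 < a + t → 0 < 1 + t →
      HasDerivAt (fun t => Real.log (a + t) - Real.log (1 + t)) (1 / (a + t) - 1 / (1 + t)) t := by
    intro a t h1 h2
    exact (((hasDerivAt_id t).const_add a).log h1.ne').sub
      (((hasDerivAt_id t).const_add 1).log h2.ne')
  have hder : ∀ t, 0 < t → HasDerivAt G (G' t) t := by
    intro t ht
    refine HasDerivAt.add (HasDerivAt.sub (HasDerivAt.sub ?_ ?_) ?_) ?_
    · refine HasDerivAt.fun_sum fun i _ => HasDerivAt.const_mul _ ?_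
      exact hlog _ _ (by linarith [hr i]) (by linarith)
    · refine HasDerivAt.fun_sum fun i _ => HasDerivAt.const_mul _ ?_
      exact hlog _ _ (by linarith [hs i]) (by linarith)
    · refine HasDerivAt.fun_sum fun i _ => HasDerivAt.fun_sum fun j _ => HasDerivAt.const_mul _ ?_
      exact hasDerivAt_inv_sqrt _ _ _ (by linarith [hs i]) (by linarith [hs j])
    · refine HasDerivAt.fun_sum fun i _ => HasDerivAt.const_mul _ ?_
      have hp : s i + t ≠ 0 := by linarith [hs i]
      refine HasDerivAt.congr_deriv ((hasDerivAt_const t (s i)).div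
        ((hasDerivAt_id t).const_add (s i)) hp) ?_
      simp [neg_div]
  have hpos : ∀ t, 0 < t → 0 ≤ G' t := by
    intro t ht
    have hp := pointwise_ineq W r s hW hr hs M hM t ht
    have e1 : ∑ i, r i * (1 / (r i + t) - 1 / (1 + t))
        = ∑ i, r i / (r i + t) - 1 / (1 + t) := by
      simp only [mul_sub, Finset.sum_sub_distrib, mul_one_div, ← Finset.sum_div, hr1]
    have e2 : ∑ j, (M j j).re * (1 / (s j + t) - 1 / (1 + t))
        = ∑ j, (M j j).re / (s j + t) - 1 / (1 + t) := by
      simp only [mul_sub, Finset.sum_sub_distrib, mul_one_div, ← Finset.sum_div, hM1]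
    have e3 : ∑ i, ∑ j, Complex.normSq (M i j) * (-((s i + t + (s j + t)) /
        (2 * (Real.sqrt (s i + t) * Real.sqrt (s j + t)) * ((s i + t) * (s j + t)))))
        ≤ - ∑ i, ∑ j, Complex.normSq (M i j) / ((s i + t) * (s j + t)) := by
      rw [← Finset.sum_neg_distrib]
      refine Finset.sum_le_sum fun i _ => ?_
      rw [← Finset.sum_neg_distrib]
      refine Finset.sum_le_sum fun j _ => ?_
      have := inv_sqrt_deriv_bound (s i + t) (s j + t) (by linarith [hs i]) (by linarith [hs j])
      have h5 := mul_le_mul_of_nonneg_left this (Complex.normSq_nonneg (M i j))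
      rw [mul_one_div] at h5
      linarith
    have e4 : ∑ j, (M j j).re * (-(s j / (s j + t) ^ 2))
        = - ∑ j, (M j j).re / (s j + t) + t * ∑ j, (M j j).re / (s j + t) ^ 2 := by
      rw [← Finset.sum_neg_distrib, Finset.mul_sum, ← Finset.sum_add_distrib]
      refine Finset.sum_congr rfl fun j _ => ?_
      have hp : s j + t ≠ 0 := by linarith [hs j]
      field_simp
      ring
    simp only [hG']
    linarith
  have hmono : MonotoneOn G (Set.Ioi 0) := by
    refine monotoneOn_of_deriv_nonneg (convex_Ioi 0) ?_ ?_ ?_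
    · exact fun t ht => (hder t ht).continuousAt.continuousWithinAt
    · intro t ht
      rw [interior_Ioi] at ht
      exact (hder t ht).differentiableAt.differentiableWithinAt
    · intro t ht
      rw [interior_Ioi] at ht
      rw [(hder t ht).deriv]
      exact hpos t ht
  have hadd : ∀ a : ℝ, Tendsto (fun t : ℝ => a + t) atTop atTop := fun a =>
    tendsto_atTop_add_const_left _ _ tendsto_id
  have hinf : Tendsto G atTop (𝓝 0) := by
    have : Tendsto G atTop (𝓝 (∑ i, r i * 0 - ∑ j, (M j j).re * 0
        - ∑ i, ∑ j, Complex.normSq (M i j) * 0 + ∑ j, (M j j).re * 0)) := by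
      refine Tendsto.add (Tendsto.sub (Tendsto.sub ?_ ?_) ?_) ?_
      · exact tendsto_finsetSum _ fun i _ => (tendsto_log_ratio _).const_mul _
      · exact tendsto_finsetSum _ fun i _ => (tendsto_log_ratio _).const_mul _
      · refine tendsto_finsetSum _ fun i _ => tendsto_finsetSum _ fun j _ => Tendsto.const_mul _ ?_
        refine Tendsto.div_atTop tendsto_const_nhds ?_
        exact (Real.tendsto_sqrt_atTop.comp (hadd _)).atTop_mul_atTop₀
          (Real.tendsto_sqrt_atTop.comp (hadd _))
      · refine tendsto_finsetSum _ fun i _ => Tendsto.const_mul _ ?_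
        exact Tendsto.div_atTop tendsto_const_nhds (hadd _)
    simpa using this
  have hle : ∀ t, 0 < t → G t ≤ 0 := by
    intro t ht
    refine ge_of_tendsto hinf ?_
    filter_upwards [eventually_ge_atTop t] with u hu
    exact hmono ht (lt_of_lt_of_le ht hu) hu
  have hlog0 : ∀ a : ℝ, 0 < a →
      Tendsto (fun t : ℝ => Real.log (a + t) - Real.log (1 + t)) (𝓝[>] 0) (𝓝 (Real.log a)) := by
    intro a ha
    have hc : ContinuousAt (fun t : ℝ => Real.log (a + t) - Real.log (1 + t)) 0 := by
      refine ContinuousAt.sub (ContinuousAt.log (by fun_prop) (by simpa using ha.ne'))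
        (ContinuousAt.log (by fun_prop) (by simp))
    have := hc.tendsto
    simp only [add_zero, Real.log_one, sub_zero] at this
    exact this.mono_left nhdsWithin_le_nhds
  have hzero : Tendsto G (𝓝[>] 0) (𝓝 (∑ i, r i * Real.log (r i)
      - ∑ j, (M j j).re * Real.log (s j)
      - ∑ i, ∑ j, Complex.normSq (M i j) * (1 / (Real.sqrt (s i) * Real.sqrt (s j)))
      + ∑ j, (M j j).re)) := by
    refine Tendsto.add (Tendsto.sub (Tendsto.sub ?_ ?_) ?_) ?_
    · refine tendsto_finsetSum _ fun i _ => ?_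
      rcases (hr i).eq_or_lt with h | h
      · simp [← h]
      · exact (hlog0 _ h).const_mul _
    · refine tendsto_finsetSum _ fun i _ => ?_
      rcases (hs i).eq_or_lt with h | h
      · simp [h0 i i h.symm]
      · exact (hlog0 _ h).const_mul _
    · refine tendsto_finsetSum _ fun i _ => tendsto_finsetSum _ fun j _ => ?_
      rcases (hs i).eq_or_lt with h | h
      · simp [h0' i j h.symm]
      rcases (hs j).eq_or_lt with h' | h'
      · simp [h0 i j h'.symm]
      have h1 := Real.sqrt_pos.mpr h
      have h2 := Real.sqrt_pos.mpr h'
      refine Tendsto.const_mul _ ?_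
      have hc : ContinuousAt (fun t : ℝ => 1 / (Real.sqrt (s i + t) * Real.sqrt (s j + t))) 0 := by
        refine ContinuousAt.div continuousAt_const (by fun_prop) ?_
        simp only [add_zero]
        positivity
      have := hc.tendsto
      simp only [add_zero] at this
      exact this.mono_left nhdsWithin_le_nhds
    · refine tendsto_finsetSum _ fun i _ => ?_
      rcases (hs i).eq_or_lt with h | h
      · simp [h0 i i h.symm]
      have hc : ContinuousAt (fun t : ℝ => (M i i).re * (s i / (s i + t))) 0 := by
        refine ContinuousAt.mul continuousAt_const
          (ContinuousAt.div continuousAt_const (by fun_prop) ?_)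
        simp only [add_zero]
        exact h.ne'
      have := hc.tendsto
      simp only [add_zero, div_self h.ne', mul_one] at this
      exact this.mono_left nhdsWithin_le_nhds
  have hfin := le_of_tendsto hzero (eventually_nhdsWithin_of_forall (fun t ht => hle t ht))
  rw [hM1] at hfin
  linarith
theorem suppLE_mul_eq_zero {e : Type*} [Fintype e] {ρ σ : Matrix d d ℂ} (h : suppLE ρ σ)
    (X : Matrix d e ℂ) (hX : σ * X = 0) : ρ * X = 0 := by
  ext i j
  have h1 : σ *ᵥ (fun k => X k j) = 0 := by
    ext i
    exact congrFun (congrFun hX i) j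
  have h2 : (fun k => X k j) ∈ LinearMap.ker ρ.mulVecLin := h (by
    rw [LinearMap.mem_ker, Matrix.mulVecLin_apply]; exact h1)
  rw [LinearMap.mem_ker, Matrix.mulVecLin_apply] at h2
  exact congrFun h2 i

theorem rpow_neg_half (x : ℝ) (hx : 0 ≤ x) :
    (if x = 0 then 0 else Real.rpow x (-(1/2))) = 1 / Real.sqrt x := by
  split_ifs with h
  · simp [h]
  · change x ^ (-(1/2) : ℝ) = _
    rw [Real.rpow_neg hx, Real.sqrt_eq_rpow]
    simp only [one_div]

/-- `D(ρ‖σ) ≤ log Q₂(ρ‖σ)` in exponentiated form. -/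
theorem exp_relEnt_le {ρ σ : Matrix d d ℂ} (hρ : IsDensity ρ) (hσ : σ.PosSemidef)
    (hsupp : suppLE ρ σ) :
    Real.exp ((ρ * matLog ρ).trace.re - ((ρ * matLog σ).trace.re)) ≤ Q2R ρ σ := by
  obtain ⟨U, r, hU, hr, hρd⟩ := exists_diag hρ.1
  obtain ⟨V, s, hV, hs, hσd⟩ := exists_diag hσ
  have hV' : V * Vᴴ = 1 := mul_eq_one_comm.mp hV
  have hU' : U * Uᴴ = 1 := mul_eq_one_comm.mp hU
  set M : Matrix d d ℂ := Vᴴ * ρ * V with hM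
  have hMW : M = (Vᴴ * U) * Matrix.diagonal (fun i => (r i : ℂ)) * (Vᴴ * U)ᴴ := by
    rw [hM, Matrix.conjTranspose_mul, Matrix.conjTranspose_conjTranspose]
    conv_lhs => rw [hρd]
    simp only [Matrix.mul_assoc]
  have hW : (Vᴴ * U)ᴴ * (Vᴴ * U) = 1 := by
    rw [Matrix.conjTranspose_mul, Matrix.conjTranspose_conjTranspose, Matrix.mul_assoc,
      ← Matrix.mul_assoc V, hV', Matrix.one_mul, hU]
  have hMH : M.IsHermitian := by
    have := (hρ.1.conjTranspose_mul_mul_same V).1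
    exact this
  have htr : ∀ X : Matrix d d ℂ, (ρ * (V * X * Vᴴ)).trace = (M * X).trace := by
    intro X
    rw [Matrix.trace_mul_comm, hM, Matrix.mul_assoc, Matrix.mul_assoc, Matrix.trace_mul_comm V,
      Matrix.trace_mul_comm]
    simp only [Matrix.mul_assoc]
    rw [Matrix.trace_mul_comm]
    simp only [Matrix.mul_assoc]
    rw [Matrix.trace_mul_comm]
    simp only [Matrix.mul_assoc]
  have hr1 : ∑ i, r i = 1 := by
    have := hρ.2
    rw [hρd, Matrix.trace_mul_comm, ← Matrix.mul_assoc, hU, Matrix.one_mul,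
      Matrix.trace_diagonal] at this
    exact_mod_cast this
  have hM1 : ∑ j, (M j j).re = 1 := by
    have h1 : M.trace = 1 := by
      rw [hM, Matrix.trace_mul_comm, ← Matrix.mul_assoc, hV', Matrix.one_mul, hρ.2]
    have h2 := congrArg Complex.re h1
    rw [Matrix.trace, Complex.re_sum] at h2
    exact h2
  have h0 : ∀ i j, s j = 0 → M i j = 0 := by
    intro i j hj
    have h1 : σ * (V * Matrix.diagonal (fun i => if s i = 0 then (1 : ℂ) else 0)) = 0 := by
      rw [hσd, Matrix.mul_assoc, ← Matrix.mul_assoc Vᴴ, hV, Matrix.one_mul, Matrix.mul_assoc,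
        Matrix.diagonal_mul_diagonal]
      have : (fun i => (s i : ℂ) * (if s i = 0 then (1 : ℂ) else 0)) = fun _ => 0 := by
        ext i
        split_ifs with h <;> simp [h]
      rw [this, Matrix.diagonal_zero, Matrix.mul_zero]
    have h2 := suppLE_mul_eq_zero hsupp _ h1
    have h3 : M * Matrix.diagonal (fun i => if s i = 0 then (1 : ℂ) else 0) = 0 := by
      rw [hM, Matrix.mul_assoc, Matrix.mul_assoc, h2, Matrix.mul_zero]
    have h4 := congrFun (congrFun h3 i) j
    rw [Matrix.mul_diagonal, if_pos hj, mul_one] at h4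
    exact h4
  have h0' : ∀ i j, s i = 0 → M i j = 0 := by
    intro i j hi
    rw [← hMH.apply, h0 j i hi, star_zero]
  have q1 : (ρ * matLog ρ).trace.re = ∑ i, r i * Real.log (r i) := by
    rw [matLog, matFun_of_diag U r hU hρd]
    conv_lhs => rw [hρd]
    rw [Matrix.mul_assoc, ← Matrix.mul_assoc Uᴴ, ← Matrix.mul_assoc Uᴴ, hU, Matrix.one_mul,
      ← Matrix.mul_assoc, Matrix.trace_mul_comm, Matrix.mul_assoc U, Matrix.diagonal_mul_diagonal,
      ← Matrix.mul_assoc, hU, Matrix.one_mul, Matrix.trace_diagonal, Complex.re_sum]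
    refine Finset.sum_congr rfl fun i _ => ?_
    rw [← Complex.ofReal_mul, Complex.ofReal_re]
  have q2 : (ρ * matLog σ).trace.re = ∑ j, (M j j).re * Real.log (s j) := by
    rw [matLog, matFun_of_diag V s hV hσd, htr, Matrix.trace, Complex.re_sum]
    refine Finset.sum_congr rfl fun i _ => ?_
    rw [Matrix.diag_apply, Matrix.mul_diagonal, Complex.re_mul_ofReal]
  have q3 : Q2R ρ σ = ∑ i, ∑ j, Complex.normSq (M i j) *
      (1 / (Real.sqrt (s i) * Real.sqrt (s j))) := by
    have hp : matPow σ (-(1/2)) = V * Matrix.diagonal (fun i => ((1 / Real.sqrt (s i) : ℝ) : ℂ)) * Vᴴ := by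
      rw [matPow, matFun_of_diag V s hV hσd]
      simp only [rpow_neg_half _ (hs _)]
    rw [Q2R, hp]
    set D := Matrix.diagonal (fun i => ((1 / Real.sqrt (s i) : ℝ) : ℂ)) with hD
    have e : ρ * (V * D * Vᴴ) * ρ * (V * D * Vᴴ) = ρ * (V * (D * M * D) * Vᴴ) := by
      rw [hM]
      simp only [Matrix.mul_assoc]
    rw [e, htr, Matrix.trace, Complex.re_sum]
    refine Finset.sum_congr rfl fun i _ => ?_
    rw [Matrix.diag_apply, Matrix.mul_apply, Complex.re_sum]
    refine Finset.sum_congr rfl fun j _ => ?_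
    rw [hD, Matrix.mul_diagonal, Matrix.diagonal_mul]
    have hc : M j i = (starRingEnd ℂ) (M i j) := (hMH.apply j i).symm
    rw [hc]
    have e2 : ∀ a b : ℝ, ∀ z : ℂ, z * ((a : ℂ) * (starRingEnd ℂ) z * (b : ℂ))
        = ((Complex.normSq z * (a * b) : ℝ) : ℂ) := by
      intro a b z
      push_cast
      rw [← Complex.mul_conj]
      ring
    rw [e2, Complex.ofReal_re]
    congr 1
    rw [one_div_mul_one_div, mul_comm]
  rw [q1, q2, q3]
  set D := ∑ i, r i * Real.log (r i) - ∑ j, (M j j).re * Real.log (s j) with hDD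
  set c := Real.exp D with hc
  have hcp : 0 < c := Real.exp_pos D
  have hmain := scalar_ineq (Vᴴ * U) r (fun i => c * s i) hW hr
    (fun i => mul_nonneg hcp.le (hs i)) M hMW hr1 hM1
    (fun i j h => h0 i j ((mul_eq_zero.mp h).resolve_left hcp.ne'))
    (fun i j h => h0' i j ((mul_eq_zero.mp h).resolve_left hcp.ne'))
  have l1 : ∑ j, (M j j).re * Real.log (c * s j) = D + ∑ j, (M j j).re * Real.log (s j) := by
    have : D = ∑ j, (M j j).re * D := by rw [← Finset.sum_mul, hM1, one_mul]
    conv_rhs => rw [this]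
    rw [← Finset.sum_add_distrib]
    refine Finset.sum_congr rfl fun j _ => ?_
    by_cases h : s j = 0
    · simp [h0 j j h]
    · rw [Real.log_mul hcp.ne' h, hc, Real.log_exp]
      ring
  have l2 : ∑ i, ∑ j, Complex.normSq (M i j) *
      (1 / (Real.sqrt (c * s i) * Real.sqrt (c * s j)))
      = c⁻¹ * ∑ i, ∑ j, Complex.normSq (M i j) * (1 / (Real.sqrt (s i) * Real.sqrt (s j))) := by
    rw [Finset.mul_sum]
    refine Finset.sum_congr rfl fun i _ => ?_
    rw [Finset.mul_sum]
    refine Finset.sum_congr rfl fun j _ => ?_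
    rw [Real.sqrt_mul hcp.le, Real.sqrt_mul hcp.le, mul_mul_mul_comm, Real.mul_self_sqrt hcp.le,
      one_div, mul_inv, one_div]
    ring
  rw [l1, l2] at hmain
  have h5 : 1 ≤ c⁻¹ * ∑ i, ∑ j, Complex.normSq (M i j) *
      (1 / (Real.sqrt (s i) * Real.sqrt (s j))) := by linarith
  rwa [inv_mul_eq_div, one_le_div hcp] at h5
theorem sum_site (n : ℕ) (x : Fin n) (g : A → ℂ) (h : Fin n → A → ℂ) :
    ∑ v : Fin n → A, g (v x) * ∏ k ∈ Finset.univ.erase x, h k (v k)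
      = (∑ a, g a) * ∏ k ∈ Finset.univ.erase x, ∑ a, h k a := by
  set F : Fin n → A → ℂ := fun k a => if k = x then g a else h k a with hF
  have h1 : ∀ v : Fin n → A, g (v x) * ∏ k ∈ Finset.univ.erase x, h k (v k)
      = ∏ k, F k (v k) := by
    intro v
    rw [← Finset.mul_prod_erase Finset.univ _ (Finset.mem_univ x)]
    congr 1
    · simp [hF]
    · refine Finset.prod_congr rfl fun k hk => ?_
      simp [hF, Finset.ne_of_mem_erase hk]
  have h2 : (∑ a, g a) * ∏ k ∈ Finset.univ.erase x, ∑ a, h k a = ∏ k, ∑ a, F k a := by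
    rw [← Finset.mul_prod_erase Finset.univ _ (Finset.mem_univ x)]
    congr 1
    · simp [hF]
    · refine Finset.prod_congr rfl fun k hk => ?_
      simp [hF, Finset.ne_of_mem_erase hk]
  rw [h2, Fintype.prod_sum]
  exact Finset.sum_congr rfl fun v _ => h1 v

theorem tauX_mul (M M' : Matrix (R × A) (R × A) ℂ) (N N' : Matrix A A ℂ) (n : ℕ) (x : Fin n) :
    tauX M N n x * tauX M' N' n x = tauX (M * M') (N * N') n x := by
  ext p q
  simp only [Matrix.mul_apply, tauX, Matrix.of_apply, Fintype.sum_prod_type]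
  rw [Finset.sum_mul]
  refine Finset.sum_congr rfl fun i _ => ?_
  rw [← sum_site n x (fun a => M (p.1, p.2 x) (i, a) * M' (i, a) (q.1, q.2 x))
    (fun k a => N (p.2 k) a * N' a (q.2 k))]
  refine Finset.sum_congr rfl fun v _ => ?_
  rw [Finset.prod_mul_distrib]
  ring

theorem tauX_conjTranspose (M : Matrix (R × A) (R × A) ℂ) (N : Matrix A A ℂ) (n : ℕ) (x : Fin n) :
    (tauX M N n x)ᴴ = tauX Mᴴ Nᴴ n x := by
  ext p q
  simp [tauX, Matrix.conjTranspose_apply]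

theorem tauX_diagonal (a : R × A → ℂ) (b : A → ℂ) (n : ℕ) (x : Fin n) :
    tauX (Matrix.diagonal a) (Matrix.diagonal b) n x
      = Matrix.diagonal (fun p => a (p.1, p.2 x) * ∏ k ∈ Finset.univ.erase x, b (p.2 k)) := by
  ext p q
  by_cases h : p = q
  · subst h
    simp [tauX]
  · rw [Matrix.diagonal_apply_ne _ h]
    simp only [tauX, Matrix.of_apply]
    by_cases h1 : p.1 = q.1 ∧ p.2 x = q.2 x
    · have : ∃ k, p.2 k ≠ q.2 k := by
        by_contra hc
        push Not at hc
        exact h (Prod.ext h1.1 (funext hc))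
      obtain ⟨k, hk⟩ := this
      have hkx : k ≠ x := fun e => hk (e ▸ h1.2)
      have hz : ∏ k ∈ Finset.univ.erase x, Matrix.diagonal b (p.2 k) (q.2 k) = 0 :=
        Finset.prod_eq_zero (Finset.mem_erase.mpr ⟨hkx, Finset.mem_univ k⟩)
          (Matrix.diagonal_apply_ne b hk)
      rw [hz, mul_zero]
    · rw [Matrix.diagonal_apply_ne, zero_mul]
      intro e
      exact h1 (Prod.mk.inj e)

theorem tauX_one (n : ℕ) (x : Fin n) :
    tauX (1 : Matrix (R × A) (R × A) ℂ) (1 : Matrix A A ℂ) n x = 1 := by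
  rw [← Matrix.diagonal_one, ← Matrix.diagonal_one, tauX_diagonal]
  simp

theorem tauX_kron (B : Matrix R R ℂ) (C : Matrix A A ℂ) (n : ℕ) (x : Fin n) :
    B ⊗ₖ tpow C n = tauX (B ⊗ₖ C) C n x := by
  ext p q
  simp only [tauX, tpow, Matrix.of_apply, Matrix.kroneckerMap_apply]
  rw [← Finset.mul_prod_erase Finset.univ _ (Finset.mem_univ x), mul_assoc]

theorem trace_tauX (M : Matrix (R × A) (R × A) ℂ) (N : Matrix A A ℂ) (hN : N.trace = 1)
    (n : ℕ) (x : Fin n) : (tauX M N n x).trace = M.trace := by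
  simp only [Matrix.trace, Matrix.diag_apply, tauX, Matrix.of_apply, Fintype.sum_prod_type] at *
  refine Finset.sum_congr rfl fun i _ => ?_
  rw [sum_site n x (fun a => M (i, a) (i, a)) (fun k a => N a a)]
  simp [hN]

theorem trace_cross (M M' : Matrix (R × A) (R × A) ℂ) (N N' : Matrix A A ℂ)
    (hN : (N * N').trace = 1) (n : ℕ) (x y : Fin n) (hxy : x ≠ y) :
    (tauX M N n x * tauX M' N' n y).trace
      = (ptrace2 (M * ((1 : Matrix R R ℂ) ⊗ₖ N')) * ptrace2 (((1 : Matrix R R ℂ) ⊗ₖ N) * M')).trace := by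
  have hX : ∀ i j, ptrace2 (M * ((1 : Matrix R R ℂ) ⊗ₖ N')) i j
      = ∑ a, ∑ b, M (i, a) (j, b) * N' b a := by
    intro i j
    simp only [ptrace2, Matrix.of_apply, Matrix.mul_apply, Fintype.sum_prod_type,
      Matrix.kroneckerMap_apply]
    refine Finset.sum_congr rfl fun a _ => ?_
    rw [Finset.sum_eq_single j]
    · simp
    · intro l _ hl
      simp [Matrix.one_apply_ne hl]
    · simp
  have hY : ∀ i j, ptrace2 (((1 : Matrix R R ℂ) ⊗ₖ N) * M') j i
      = ∑ a, ∑ b, N a b * M' (j, b) (i, a) := by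
    intro i j
    simp only [ptrace2, Matrix.of_apply, Matrix.mul_apply, Fintype.sum_prod_type,
      Matrix.kroneckerMap_apply]
    refine Finset.sum_congr rfl fun a _ => ?_
    rw [Finset.sum_eq_single j]
    · simp
    · intro l _ hl
      simp [Matrix.one_apply_ne hl.symm]
    · simp
  have hN' : ∑ a, ∑ b, N a b * N' b a = 1 := by
    rw [← hN]; rfl
  rw [Matrix.trace, Matrix.trace]
  simp only [Matrix.diag_apply, Matrix.mul_apply (M := ptrace2 _), Fintype.sum_prod_type]
  simp only [Matrix.mul_apply (M := tauX _ _ _ _), Fintype.sum_prod_type]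
  refine Finset.sum_congr rfl fun i _ => ?_
  rw [Finset.sum_comm]
  refine Finset.sum_congr rfl fun j _ => ?_
  rw [hX, hY]
  set F : Fin n → A → A → ℂ := fun k a b =>
    if k = x then M (i, a) (j, b) * N' b a else
    if k = y then N a b * M' (j, b) (i, a) else N a b * N' b a with hF
  have h1 : ∀ v w : Fin n → A, tauX M N n x (i, v) (j, w) * tauX M' N' n y (j, w) (i, v)
      = ∏ k, F k (v k) (w k) := by
    intro v w
    have hy : y ∈ Finset.univ.erase x := Finset.mem_erase.mpr ⟨hxy.symm, Finset.mem_univ y⟩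
    have hx : x ∈ Finset.univ.erase y := Finset.mem_erase.mpr ⟨hxy, Finset.mem_univ x⟩
    simp only [tauX, Matrix.of_apply]
    rw [← Finset.mul_prod_erase Finset.univ _ (Finset.mem_univ x),
      ← Finset.mul_prod_erase (Finset.univ.erase x) _ hy,
      ← Finset.mul_prod_erase (Finset.univ.erase x) _ hy,
      ← Finset.mul_prod_erase (Finset.univ.erase y) _ hx,
      Finset.erase_right_comm (a := y) (b := x)]
    have h3 : ∏ k ∈ (Finset.univ.erase x).erase y, F k (v k) (w k)
        = (∏ k ∈ (Finset.univ.erase x).erase y, N (v k) (w k))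
          * ∏ k ∈ (Finset.univ.erase x).erase y, N' (w k) (v k) := by
      rw [← Finset.prod_mul_distrib]
      refine Finset.prod_congr rfl fun k hk => ?_
      have h4 := Finset.ne_of_mem_erase hk
      have h5 := Finset.ne_of_mem_erase (Finset.mem_of_mem_erase hk)
      simp [hF, h4, h5]
    have h6 : F x (v x) (w x) = M (i, v x) (j, w x) * N' (w x) (v x) := by simp [hF]
    have h7 : F y (v y) (w y) = N (v y) (w y) * M' (j, w y) (i, v y) := by
      simp [hF, hxy.symm]
    rw [h3, h6, h7]
    ring
  calc ∑ v : Fin n → A, ∑ w : Fin n → A,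
        tauX M N n x (i, v) (j, w) * tauX M' N' n y (j, w) (i, v)
      = ∑ v : Fin n → A, ∑ w : Fin n → A, ∏ k, F k (v k) (w k) := by simp only [h1]
    _ = ∑ v : Fin n → A, ∏ k, ∑ b, F k (v k) b := by
        refine Finset.sum_congr rfl fun v _ => ?_
        rw [Fintype.prod_sum]
    _ = ∏ k, ∑ a, ∑ b, F k a b := by
        rw [Fintype.prod_sum]
    _ = (∑ a, ∑ b, F x a b) * (∑ a, ∑ b, F y a b) := by
        refine Fintype.prod_eq_mul x y hxy ?_
        intro k hk
        simp only [hF, if_neg hk.1, if_neg hk.2]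
        exact hN'
    _ = _ := by
        simp only [hF, if_true, if_neg hxy.symm]

theorem mult_prod {ι : Type*} (f : ℝ → ℝ) (hf1 : f 1 = 1)
    (hfm : ∀ a b, 0 ≤ a → 0 ≤ b → f (a * b) = f a * f b) (s : Finset ι) (g : ι → ℝ)
    (hg : ∀ i, 0 ≤ g i) : f (∏ i ∈ s, g i) = ∏ i ∈ s, f (g i) := by
  induction s using Finset.induction_on with
  | empty => simpa using hf1
  | insert a s ha ih =>
    rw [Finset.prod_insert ha, Finset.prod_insert ha, hfm _ _ (hg a)
      (Finset.prod_nonneg fun i _ => hg i), ih]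

theorem matFun_kron (f : ℝ → ℝ)
    (hfm : ∀ a b, 0 ≤ a → 0 ≤ b → f (a * b) = f a * f b)
    {B : Matrix R R ℂ} {C : Matrix A A ℂ} (hB : B.PosSemidef) (hC : C.PosSemidef) :
    matFun (B ⊗ₖ C) f = matFun B f ⊗ₖ matFun C f := by
  obtain ⟨U, a, hU, ha, hBd⟩ := exists_diag hB
  obtain ⟨V, b, hV, hb, hCd⟩ := exists_diag hC
  have hdd : ∀ (a' : R → ℝ) (b' : A → ℝ),
      (U * Matrix.diagonal (fun i => (a' i : ℂ)) * Uᴴ) ⊗ₖ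
        (V * Matrix.diagonal (fun i => (b' i : ℂ)) * Vᴴ)
      = (U ⊗ₖ V) * Matrix.diagonal (fun p : R × A => ((a' p.1 * b' p.2 : ℝ) : ℂ)) * (U ⊗ₖ V)ᴴ := by
    intro a' b'
    rw [Matrix.mul_kronecker_mul, Matrix.mul_kronecker_mul, Matrix.diagonal_kronecker_diagonal,
      Matrix.conjTranspose_kronecker]
    simp
  have h1 : B ⊗ₖ C = (U ⊗ₖ V) * Matrix.diagonal (fun p : R × A => ((a p.1 * b p.2 : ℝ) : ℂ))
      * (U ⊗ₖ V)ᴴ := by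
    rw [← hdd, ← hBd, ← hCd]
  rw [matFun_of_diag (U ⊗ₖ V) _ ?_ h1, matFun_of_diag U a hU hBd, matFun_of_diag V b hV hCd, hdd]
  · simp only [hfm _ _ (ha _) (hb _)]
  · rw [Matrix.conjTranspose_kronecker, ← Matrix.mul_kronecker_mul, hU, hV,
      Matrix.one_kronecker_one]

theorem matFun_tauX (f : ℝ → ℝ) (hf1 : f 1 = 1)
    (hfm : ∀ a b, 0 ≤ a → 0 ≤ b → f (a * b) = f a * f b)
    {B : Matrix (R × A) (R × A) ℂ} {C : Matrix A A ℂ} (hB : B.PosSemidef) (hC : C.PosSemidef)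
    (n : ℕ) (x : Fin n) :
    matFun (tauX B C n x) f = tauX (matFun B f) (matFun C f) n x := by
  obtain ⟨U, a, hU, ha, hBd⟩ := exists_diag hB
  obtain ⟨V, b, hV, hb, hCd⟩ := exists_diag hC
  have hdd : ∀ (a' : R × A → ℝ) (b' : A → ℝ),
      tauX (U * Matrix.diagonal (fun i => (a' i : ℂ)) * Uᴴ)
        (V * Matrix.diagonal (fun i => (b' i : ℂ)) * Vᴴ) n x
      = tauX U V n x * Matrix.diagonal (fun p : R × (Fin n → A) =>
        ((a' (p.1, p.2 x) * ∏ k ∈ Finset.univ.erase x, b' (p.2 k) : ℝ) : ℂ)) * (tauX U V n x)ᴴ := by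
    intro a' b'
    rw [tauX_conjTranspose, ← tauX_mul, ← tauX_mul, tauX_diagonal]
    simp
  have h1 := hdd a b
  rw [← hBd, ← hCd] at h1
  rw [matFun_of_diag (tauX U V n x) _ ?_ h1, matFun_of_diag U a hU hBd, matFun_of_diag V b hV hCd,
    hdd]
  · simp only [hfm _ _ (ha _) (Finset.prod_nonneg fun i _ => hb _),
      mult_prod f hf1 hfm _ _ (fun _ => hb _)]
  · rw [tauX_conjTranspose, tauX_mul, hU, hV, tauX_one]

theorem tauX_posSemidef {B : Matrix (R × A) (R × A) ℂ} {C : Matrix A A ℂ} (hB : B.PosSemidef)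
    (hC : C.PosSemidef) (n : ℕ) (x : Fin n) : (tauX B C n x).PosSemidef := by
  obtain ⟨E, hE⟩ := exists_sq hB
  obtain ⟨F, hF⟩ := exists_sq hC
  rw [hE, hF, ← tauX_mul, ← tauX_conjTranspose]
  exact Matrix.posSemidef_conjTranspose_mul_self _

theorem pow_mult : ∀ a b : ℝ, 0 ≤ a → 0 ≤ b →
    (fun x : ℝ => if x = 0 then 0 else Real.rpow x (-(1/2))) (a * b)
      = (fun x : ℝ => if x = 0 then 0 else Real.rpow x (-(1/2))) a
        * (fun x : ℝ => if x = 0 then 0 else Real.rpow x (-(1/2))) b := by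
  intro a b ha hb
  simp only
  rw [rpow_neg_half _ ha, rpow_neg_half _ hb, rpow_neg_half _ (mul_nonneg ha hb),
    Real.sqrt_mul ha, one_div_mul_one_div]

theorem pow_facts {σ : Matrix d d ℂ} (hσ : σ.PosSemidef) :
    matPow σ (-(1/2)) * σ = σ * matPow σ (-(1/2)) ∧
      σ * (matPow σ (-(1/2)) * σ * matPow σ (-(1/2))) = σ := by
  obtain ⟨V, s, hV, hs, hσd⟩ := exists_diag hσ
  have hp : matPow σ (-(1/2)) = V * Matrix.diagonal (fun i => ((1 / Real.sqrt (s i) : ℝ) : ℂ)) * Vᴴ := by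
    rw [matPow, matFun_of_diag V s hV hσd]
    simp only [rpow_neg_half _ (hs _)]
  have hmul : ∀ f g : d → ℝ, (V * Matrix.diagonal (fun i => (f i : ℂ)) * Vᴴ) *
      (V * Matrix.diagonal (fun i => (g i : ℂ)) * Vᴴ)
      = V * Matrix.diagonal (fun i => ((f i * g i : ℝ) : ℂ)) * Vᴴ := by
    intro f g
    calc _ = V * Matrix.diagonal (fun i => (f i : ℂ)) * (Vᴴ * V) *
          Matrix.diagonal (fun i => (g i : ℂ)) * Vᴴ := by simp only [Matrix.mul_assoc]
      _ = _ := by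
        rw [hV, Matrix.mul_one, Matrix.mul_assoc V, Matrix.diagonal_mul_diagonal]
        simp
  rw [hp]
  constructor
  · rw [hσd, hmul, hmul]
    simp only [mul_comm]
  · rw [hσd, hmul, hmul, hmul]
    congr 3
    ext i
    rcases (hs i).eq_or_lt with h | h
    · simp [← h]
    · have h1 := Real.sqrt_pos.mpr h
      have h2 : s i * (1 / Real.sqrt (s i) * s i * (1 / Real.sqrt (s i))) = s i := by
        have h3 := Real.sq_sqrt h.le
        field_simp
        rw [h3]
      rw [h2]
theorem ptrace2_posSemidef {ρ : Matrix (R × A) (R × A) ℂ} (hρ : ρ.PosSemidef) :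
    (ptrace2 ρ).PosSemidef := by
  have : ptrace2 ρ = ∑ a : A, ρ.submatrix (fun i : R => (i, a)) (fun i : R => (i, a)) := by
    ext i j
    simp [ptrace2, Matrix.sum_apply]
  rw [this]
  exact Matrix.posSemidef_sum _ fun a _ => hρ.submatrix _

theorem trace_ptrace2 (ρ : Matrix (R × A) (R × A) ℂ) : (ptrace2 ρ).trace = ρ.trace := by
  simp [ptrace2, Matrix.trace, Fintype.sum_prod_type]

theorem kron_one_mul_apply (X : Matrix R R ℂ) (Y : Matrix (R × A) (R × A) ℂ) (i : R) (a : A)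
    (q : R × A) : ((X ⊗ₖ (1 : Matrix A A ℂ)) * Y) (i, a) q = ∑ j, X i j * Y (j, a) q := by
  rw [Matrix.mul_apply, Fintype.sum_prod_type]
  refine Finset.sum_congr rfl fun j _ => ?_
  rw [Finset.sum_eq_single a]
  · simp
  · intro b _ hb
    simp [Matrix.one_apply_ne hb.symm]
  · simp

theorem mul_kron_one_apply (X : Matrix R R ℂ) (Y : Matrix (R × A) (R × A) ℂ) (i : R) (a : A)
    (q : R × A) : (Y * (X ⊗ₖ (1 : Matrix A A ℂ))) q (i, a) = ∑ j, Y q (j, a) * X j i := by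
  rw [Matrix.mul_apply, Fintype.sum_prod_type]
  refine Finset.sum_congr rfl fun j _ => ?_
  rw [Finset.sum_eq_single a]
  · simp
  · intro b _ hb
    simp [Matrix.one_apply_ne hb]
  · simp

theorem ptrace2_left (X : Matrix R R ℂ) (Y : Matrix (R × A) (R × A) ℂ) :
    ptrace2 ((X ⊗ₖ (1 : Matrix A A ℂ)) * Y) = X * ptrace2 Y := by
  ext i j
  simp only [ptrace2, Matrix.of_apply, kron_one_mul_apply, Matrix.mul_apply (M := X),
    Finset.mul_sum]
  rw [Finset.sum_comm]

theorem ptrace2_right (X : Matrix R R ℂ) (Y : Matrix (R × A) (R × A) ℂ) :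
    ptrace2 (Y * (X ⊗ₖ (1 : Matrix A A ℂ))) = ptrace2 Y * X := by
  ext i j
  simp only [ptrace2, Matrix.of_apply, mul_kron_one_apply, Matrix.mul_apply (N := X),
    Finset.sum_mul]
  rw [Finset.sum_comm]

theorem ptrace2_cyclic (B : Matrix A A ℂ) (Y : Matrix (R × A) (R × A) ℂ) :
    ptrace2 (((1 : Matrix R R ℂ) ⊗ₖ B) * Y) = ptrace2 (Y * ((1 : Matrix R R ℂ) ⊗ₖ B)) := by
  ext i j
  simp only [ptrace2, Matrix.of_apply, Matrix.mul_apply, Fintype.sum_prod_type,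
    Matrix.kroneckerMap_apply]
  have h1 : ∀ a, ∑ l, ∑ b, (1 : Matrix R R ℂ) i l * B a b * Y (l, b) (j, a)
      = ∑ b, B a b * Y (i, b) (j, a) := by
    intro a
    rw [Finset.sum_eq_single i]
    · simp
    · intro l _ hl
      simp [Matrix.one_apply_ne hl.symm]
    · simp
  have h2 : ∀ a, ∑ l, ∑ b, Y (i, a) (l, b) * ((1 : Matrix R R ℂ) l j * B b a)
      = ∑ b, B b a * Y (i, a) (j, b) := by
    intro a
    rw [Finset.sum_eq_single j]
    · simp [mul_comm]
    · intro l _ hl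
      simp [Matrix.one_apply_ne hl]
    · simp
  simp only [h1, h2]
  rw [Finset.sum_comm]

theorem suppLE_of_mul {ρ σ Z : Matrix d d ℂ} (h : ρ * (Z * σ) = ρ) : suppLE ρ σ := by
  intro v hv
  rw [LinearMap.mem_ker, Matrix.mulVecLin_apply] at hv ⊢
  rw [← h, ← Matrix.mulVec_mulVec, ← Matrix.mulVec_mulVec, hv, Matrix.mulVec_zero,
    Matrix.mulVec_zero]

set_option maxHeartbeats 400000 in
theorem convex_split_real (n : ℕ) (hn : 0 < n)
    (ρ : Matrix (R × A) (R × A) ℂ) (hρ : IsDensity ρ)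
    (σ : Matrix A A ℂ) (hσ : IsDensity σ) (hsupp : suppLE ρ (ptrace2 ρ ⊗ₖ σ)) :
    IsDensity ((n : ℂ)⁻¹ • ∑ x : Fin n, tauX ρ σ n x) ∧
    (ptrace2 ρ ⊗ₖ tpow σ n).PosSemidef ∧
    suppLE ((n : ℂ)⁻¹ • ∑ x : Fin n, tauX ρ σ n x) (ptrace2 ρ ⊗ₖ tpow σ n) ∧
    Q2R ((n : ℂ)⁻¹ • ∑ x : Fin n, tauX ρ σ n x) (ptrace2 ρ ⊗ₖ tpow σ n)
      = 1 + (Q2R ρ (ptrace2 ρ ⊗ₖ σ) - 1) / n := by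
  have hn0 : (n : ℂ) ≠ 0 := by exact_mod_cast hn.ne'
  have hn0' : (n : ℝ) ≠ 0 := by exact_mod_cast hn.ne'
  set ρR := ptrace2 ρ with hρR
  have hRp : ρR.PosSemidef := ptrace2_posSemidef hρ.1
  have hRt : ρR.trace = 1 := by rw [hρR, trace_ptrace2, hρ.2]
  set ω := ρR ⊗ₖ σ with hω
  have hωp : ω.PosSemidef := hRp.kronecker hσ.1
  have hωn : ∀ x : Fin n, ρR ⊗ₖ tpow σ n = tauX ω σ n x := fun x => tauX_kron ρR σ n x
  set SR := matPow ρR (-(1/2)) with hSR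
  set S := matPow σ (-(1/2)) with hS
  have hSω : matPow ω (-(1/2)) = SR ⊗ₖ S := matFun_kron _ pow_mult hRp hσ.1
  have hSn : ∀ x : Fin n, matPow (ρR ⊗ₖ tpow σ n) (-(1/2)) = tauX (SR ⊗ₖ S) S n x := by
    intro x
    rw [hωn x, ← hSω]
    refine matFun_tauX _ ?_ pow_mult hωp hσ.1 n x
    simp
  obtain ⟨cR, fR⟩ := pow_facts hRp
  obtain ⟨cS, fS⟩ := pow_facts hσ.1
  obtain ⟨cω, fω⟩ := pow_facts hωp
  rw [← hSR] at cR fR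
  rw [← hS] at cS fS
  -- support facts
  have hρω : ρ * (matPow ω (-(1/2)) * ω * matPow ω (-(1/2))) = ρ := by
    have h1 : ω * (1 - matPow ω (-(1/2)) * ω * matPow ω (-(1/2))) = 0 := by
      rw [Matrix.mul_sub, Matrix.mul_one, fω, sub_self]
    have h2 := suppLE_mul_eq_zero hsupp _ h1
    rw [Matrix.mul_sub, Matrix.mul_one, sub_eq_zero] at h2
    exact h2.symm
  have hρP : ρ * ((1 : Matrix R R ℂ) ⊗ₖ (S * σ * S)) = ρ := by
    have h1 : ω * (1 - (1 : Matrix R R ℂ) ⊗ₖ (S * σ * S)) = 0 := by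
      rw [Matrix.mul_sub, Matrix.mul_one, hω, ← Matrix.mul_kronecker_mul, fS, Matrix.mul_one,
        sub_self]
    have h2 := suppLE_mul_eq_zero hsupp _ h1
    rw [Matrix.mul_sub, Matrix.mul_one, sub_eq_zero] at h2
    exact h2.symm
  have hτp : ∀ x : Fin n, (tauX ρ σ n x).PosSemidef := tauX_posSemidef hρ.1 hσ.1 n
  refine ⟨⟨?_, ?_⟩, ?_, ?_, ?_⟩
  · refine Matrix.PosSemidef.smul (Matrix.posSemidef_sum _ fun x _ => hτp x) ?_
    have : (0 : ℂ) ≤ (((n : ℝ)⁻¹ : ℝ) : ℂ) := Complex.zero_le_real.mpr (by positivity)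
    simpa using this
  · rw [Matrix.trace_smul, Matrix.trace_sum]
    simp only [trace_tauX ρ σ hσ.2, hρ.2]
    simp [hn0]
  · rw [hωn ⟨0, hn⟩]
    exact tauX_posSemidef hωp hσ.1 n _
  · refine suppLE_of_mul (Z := matPow (ρR ⊗ₖ tpow σ n) (-(1/2)) * matPow (ρR ⊗ₖ tpow σ n) (-(1/2))) ?_
    rw [Matrix.smul_mul, Matrix.sum_mul]
    congr 1
    refine Finset.sum_congr rfl fun x _ => ?_
    rw [hSn x, hωn x, tauX_mul, tauX_mul, tauX_mul, ← hSω]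
    have g1 : ρ * (matPow ω (-(1/2)) * matPow ω (-(1/2)) * ω) = ρ := by
      rw [Matrix.mul_assoc (matPow ω (-(1/2))), cω, ← Matrix.mul_assoc (matPow ω (-(1/2))), hρω]
    have g2 : σ * (S * S * σ) = σ := by
      rw [Matrix.mul_assoc S, cS, ← Matrix.mul_assoc S, fS]
    rw [g1, g2]
  · set T := matPow (ρR ⊗ₖ tpow σ n) (-(1/2)) with hT
    set q := (ρ * (SR ⊗ₖ S) * ρ * (SR ⊗ₖ S)).trace with hq
    have hfS : σ * S * σ * S = σ := by
      conv_rhs => rw [← fS]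
      simp only [Matrix.mul_assoc]
    have hdiag : ∀ x : Fin n, (tauX ρ σ n x * T * tauX ρ σ n x * T).trace = q := by
      intro x
      rw [hSn x, tauX_mul, tauX_mul, tauX_mul, hfS, trace_tauX _ _ hσ.2]
    have hoff : ∀ x y : Fin n, x ≠ y → (tauX ρ σ n x * T * tauX ρ σ n y * T).trace = 1 := by
      intro x y hxy
      rw [Matrix.mul_assoc, Matrix.mul_assoc, ← Matrix.mul_assoc T, hSn y, tauX_mul, tauX_mul,
        trace_cross _ _ _ _ (by rw [fS, hσ.2]) n x y hxy, hρP, ← hρR]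
      have e1 : ((1 : Matrix R R ℂ) ⊗ₖ σ) * ((SR ⊗ₖ S) * ρ * (SR ⊗ₖ S))
          = (SR ⊗ₖ (1 : Matrix A A ℂ)) * ((((1 : Matrix R R ℂ) ⊗ₖ (σ * S)) *
            (ρ * ((1 : Matrix R R ℂ) ⊗ₖ S))) * (SR ⊗ₖ (1 : Matrix A A ℂ))) := by
        have a1 : ((1 : Matrix R R ℂ) ⊗ₖ σ) * (SR ⊗ₖ S)
            = (SR ⊗ₖ (1 : Matrix A A ℂ)) * ((1 : Matrix R R ℂ) ⊗ₖ (σ * S)) := by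
          rw [← Matrix.mul_kronecker_mul, ← Matrix.mul_kronecker_mul]
          simp
        have a2 : SR ⊗ₖ S = ((1 : Matrix R R ℂ) ⊗ₖ S) * (SR ⊗ₖ (1 : Matrix A A ℂ)) := by
          rw [← Matrix.mul_kronecker_mul]
          simp
        rw [← Matrix.mul_assoc, ← Matrix.mul_assoc, a1]
        conv_lhs => rw [a2]
        simp only [Matrix.mul_assoc]
      rw [e1, ptrace2_left, ptrace2_right, ptrace2_cyclic, Matrix.mul_assoc,
        ← Matrix.mul_kronecker_mul, Matrix.one_mul, ← Matrix.mul_assoc S, hρP, ← hρR,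
        ← Matrix.mul_assoc SR, fR, hRt]
    have hsum : (((n : ℂ)⁻¹ • ∑ x : Fin n, tauX ρ σ n x) * T *
        ((n : ℂ)⁻¹ • ∑ x : Fin n, tauX ρ σ n x) * T).trace
        = (n : ℂ)⁻¹ * ((n : ℂ)⁻¹ * ∑ x : Fin n, ∑ y : Fin n,
          (tauX ρ σ n x * T * tauX ρ σ n y * T).trace) := by
      simp only [Matrix.smul_mul, Matrix.mul_smul, Matrix.trace_smul, smul_eq_mul,
        Matrix.sum_mul, Matrix.mul_sum, Matrix.trace_sum]
      rw [← Finset.mul_sum, Finset.sum_comm]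
    have hval : ∑ x : Fin n, ∑ y : Fin n, (tauX ρ σ n x * T * tauX ρ σ n y * T).trace
        = n * (n + (q - 1)) := by
      have : ∀ x : Fin n, ∑ y : Fin n, (tauX ρ σ n x * T * tauX ρ σ n y * T).trace
          = n + (q - 1) := by
        intro x
        have h1 : ∀ y : Fin n, (tauX ρ σ n x * T * tauX ρ σ n y * T).trace
            = 1 + if x = y then q - 1 else 0 := by
          intro y
          split_ifs with h
          · subst h
            rw [hdiag]
            ring
          · rw [hoff x y h, add_zero]
        simp only [h1, Finset.sum_add_distrib]
        simp
      simp [this]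
      ring
    have hQ : Q2R ρ ω = q.re := by
      rw [Q2R, hSω]
    rw [hQ, Q2R, ← hT, hsum, hval]
    have : (n : ℂ)⁻¹ * ((n : ℂ)⁻¹ * (n * (n + (q - 1)))) = 1 + (((n : ℝ)⁻¹ : ℝ) : ℂ) * (q - 1) := by
      push_cast
      field_simp
    rw [this, Complex.add_re, Complex.re_ofReal_mul, Complex.sub_re, Complex.one_re]
    rw [inv_mul_eq_div]


/-- **Convex split lemma, Umegaki form**:
`D(τ ‖ ρ^R ⊗ σ^{⊗n}) ≤ log(1 + μ/n)` with `μ = Q₂(ρ^{RA} ‖ ρ^R ⊗ σ) − 1`. -/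
theorem convex_split_umegaki (n : ℕ) (hn : 0 < n)
    (ρ : Matrix (R × A) (R × A) ℂ) (hρ : IsDensity ρ)
    (σ : Matrix A A ℂ) (hσ : IsDensity σ) :
    relEnt ((n : ℂ)⁻¹ • ∑ x : Fin n, tauX ρ σ n x) (ptrace2 ρ ⊗ₖ tpow σ n)
      ≤ ENNReal.log (1 + (Q2 ρ (ptrace2 ρ ⊗ₖ σ) - 1) / n) := by
  by_cases hsupp : suppLE ρ (ptrace2 ρ ⊗ₖ σ)
  · obtain ⟨h1, h2, h3, h4⟩ := convex_split_real n hn ρ hρ σ hσ hsupp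
    have h5 := exp_relEnt_le h1 h2 h3
    rw [h4] at h5
    rw [relEnt, if_pos h3, Q2, if_pos hsupp]
    set D := ((((n : ℂ)⁻¹ • ∑ x : Fin n, tauX ρ σ n x) *
      matLog ((n : ℂ)⁻¹ • ∑ x : Fin n, tauX ρ σ n x)).trace.re -
      (((n : ℂ)⁻¹ • ∑ x : Fin n, tauX ρ σ n x) * matLog (ptrace2 ρ ⊗ₖ tpow σ n)).trace.re) with hD
    have h6 : (D : EReal) = ENNReal.log (ENNReal.ofReal (Real.exp D)) := by
      rw [ENNReal.log_ofReal_of_pos (Real.exp_pos D), Real.log_exp]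
    rw [h6]
    refine ENNReal.log_le_log ?_
    have hnp : (0 : ℝ) < n := by exact_mod_cast hn
    refine (ENNReal.ofReal_le_ofReal h5).trans (ENNReal.ofReal_add_le.trans ?_)
    rw [ENNReal.ofReal_one, ENNReal.ofReal_div_of_pos hnp, ENNReal.ofReal_sub _ zero_le_one,
      ENNReal.ofReal_one, ENNReal.ofReal_natCast]
  · rw [Q2, if_neg hsupp]
    have : ((∞ : ℝ≥0∞) - 1) / (n : ℝ≥0∞) = ∞ := by
      rw [ENNReal.top_sub ENNReal.one_ne_top, ENNReal.top_div_of_ne_top (ENNReal.natCast_ne_top n)]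
    rw [this, add_top, ENNReal.log_top]
    exact le_top
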